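/- Let V be a vector space over a division ring, L = Lt(V) its lattice of subspaces, and ā a 4-frame of L. Then there is a unique linear isomorphism ε : a₁ → a₂ such that a_{12} = {v − ε(v) : v ∈ a₁}. Moreover, the map Γ defined by Γ(f) = {v − ε(f(v)) : v ∈ a₁} is a bijection from GL(a₁), the group of linear automorphisms of the subspace a₁, onto G(L,ā), and Γ is a group isomorphism onto G(L,ā) equipped with the multiplication (g, h) ↦ t(g, h, ā) and neutral element a_{12}; in particular Γ(f₁ ∘ f₂) = t(Γ(f₁), Γ(f₂), ā) for all f₁, f₂ ∈ GL(a₁). -/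

import Mathlib

variable {L : Type*} [Lattice L] {n : ℕ}

/-- The join `∑_{i ∈ I} a i`, where the empty join is `bot`. -/
def frameSum (bot : L) (a : Fin n → L) (I : Finset (Fin n)) : L :=
  I.fold (· ⊔ ·) bot a

/-- An `n`-frame in a lattice `L`: elements `a i` (`i < n`), `e i j = a_{ij}`,
with bottom `bot = a_⊥` and top `top = a_⊤`.  An `n`-frame *of* a bounded
lattice is an `n`-frame with `bot = ⊥` and `top = ⊤`. -/
structure IsFrame (bot top : L) (a : Fin n → L) (e : Fin n → Fin n → L) : Prop where
  symm : ∀ i j : Fin n, e i j = e j i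
  inf_sum : ∀ I J : Finset (Fin n),
    frameSum bot a I ⊓ frameSum bot a J = frameSum bot a (I ∩ J)
  top_def : top = frameSum bot a Finset.univ
  sup_e : ∀ i j : Fin n, i ≠ j → a i ⊔ a j = a i ⊔ e i j
  inf_e : ∀ i j : Fin n, i ≠ j → a i ⊓ e i j = bot
  trans_e : ∀ i j k : Fin n, i ≠ j → j ≠ k → i ≠ k →
    e i k = (a i ⊔ a k) ⊓ (e i j ⊔ e j k)

/-- `G(L,ā) = {g : g ⊔ a₁ = g ⊔ a₂ = a₁ ⊔ a₂, g ⊓ a₁ = g ⊓ a₂ = ⊥}`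
(indices shifted: `a₁ = a 0`, `a₂ = a 1`). -/
def frameG [BoundedOrder L] (a : Fin 4 → L) : Set L :=
  {g | g ⊔ a 0 = a 0 ⊔ a 1 ∧ g ⊔ a 1 = a 0 ⊔ a 1 ∧ g ⊓ a 0 = ⊥ ∧ g ⊓ a 1 = ⊥}

/-- The lattice term
`t(x,y,ā) = (((y ⊔ ((((x ⊔ a₂₃) ⊓ (a₁ ⊔ a₃)) ⊔ a₁₂) ⊓ (a₂ ⊔ a₃))) ⊓ (a₁ ⊔ a₃)) ⊔ a₂₃) ⊓ (a₁ ⊔ a₂)`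
(indices shifted: `a₁ = a 0`, `a₂ = a 1`, `a₃ = a 2`, `a_{ij} = e (i-1) (j-1)`). -/
def frameMul (a : Fin 4 → L) (e : Fin 4 → Fin 4 → L) (x y : L) : L :=
  (((y ⊔ ((((x ⊔ e 1 2) ⊓ (a 0 ⊔ a 2)) ⊔ e 0 1) ⊓ (a 1 ⊔ a 2))) ⊓ (a 0 ⊔ a 2)) ⊔ e 1 2)
    ⊓ (a 0 ⊔ a 1)

variable {F V : Type*} [DivisionRing F] [AddCommGroup V] [Module F V]

/-- `Γ(f) = {v - ε(f(v)) : v ∈ a₁}`, as a subspace of `V`. -/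
def Gamma {a1 a2 : Submodule F V} (ε : a1 ≃ₗ[F] a2) (f : a1 ≃ₗ[F] a1) :
    Submodule F V :=
  LinearMap.range (a1.subtype - a2.subtype ∘ₗ ε.toLinearMap ∘ₗ f.toLinearMap)

/-- The graph-like subspace `{v - φ v : v ∈ A}` of a linear map `φ : A → B`. -/
def negGraph {A B : Submodule F V} (φ : A →ₗ[F] B) : Submodule F V :=
  LinearMap.range (A.subtype - B.subtype ∘ₗ φ)

theorem mem_negGraph {A B : Submodule F V} {φ : A →ₗ[F] B} {w : V} :
    w ∈ negGraph φ ↔ ∃ v : A, w = (v : V) - (φ v : V) := by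
  simp [negGraph, LinearMap.mem_range, eq_comm]

theorem negGraph_symm {A B : Submodule F V} (φ : A ≃ₗ[F] B) :
    negGraph φ.symm.toLinearMap = negGraph φ.toLinearMap := by
  ext w
  simp only [mem_negGraph]
  constructor
  · rintro ⟨v, rfl⟩
    exact ⟨-φ.symm v, by simp; abel⟩
  · rintro ⟨v, rfl⟩
    exact ⟨-φ v, by simp; abel⟩

/-- Elements of disjoint subspaces with equal differences agree componentwise. -/
theorem eq_and_eq_of_sub_eq_sub {A B : Submodule F V} (h : A ⊓ B = ⊥) {v v' : A} {w w' : B}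
    (hvw : (v : V) - w = (v' : V) - w') : v = v' ∧ w = w' := by
  have hA : (v : V) - v' = w - w' := by
    rw [sub_eq_sub_iff_add_eq_add] at hvw ⊢
    rw [hvw, add_comm]
  have hmem : (v : V) - v' ∈ A ⊓ B :=
    ⟨A.sub_mem v.2 v'.2, hA ▸ B.sub_mem w.2 w'.2⟩
  rw [h, Submodule.mem_bot] at hmem
  exact ⟨Subtype.ext (sub_eq_zero.mp hmem), Subtype.ext (sub_eq_zero.mp (hA ▸ hmem))⟩

theorem negGraph_injective {A B : Submodule F V} (h : A ⊓ B = ⊥) :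
    Function.Injective (negGraph : (A →ₗ[F] B) → Submodule F V) := by
  intro φ ψ hφψ
  ext v
  have hv : (v : V) - φ v ∈ negGraph ψ := hφψ ▸ mem_negGraph.mpr ⟨v, rfl⟩
  obtain ⟨v', hv'⟩ := mem_negGraph.mp hv
  obtain ⟨rfl, hw⟩ := eq_and_eq_of_sub_eq_sub h hv'
  rw [hw]

/-- The lattice expression for composition of linear maps. -/
theorem negGraph_sup_inf_eq_comp {A B C : Submodule F V} (h : B ⊓ (A ⊔ C) = ⊥)
    (φ : A →ₗ[F] B) (ψ : B →ₗ[F] C) :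
    (negGraph φ ⊔ negGraph ψ) ⊓ (A ⊔ C) = negGraph (ψ ∘ₗ φ) := by
  ext w
  constructor
  · rintro ⟨hw, hAC⟩
    obtain ⟨x, hx, y, hy, rfl⟩ := Submodule.mem_sup.mp hw
    obtain ⟨v, rfl⟩ := mem_negGraph.mp hx
    obtain ⟨u, rfl⟩ := mem_negGraph.mp hy
    have hvu : (v : V) - ψ u ∈ A ⊔ C :=
      Submodule.sub_mem _ (Submodule.mem_sup_left v.2) (Submodule.mem_sup_right (ψ u).2)
    have hu : (u : V) - φ v ∈ B ⊓ (A ⊔ C) := by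
      refine ⟨B.sub_mem u.2 (φ v).2, ?_⟩
      have hdiff := (A ⊔ C).sub_mem hAC hvu
      rwa [show (v : V) - φ v + (u - ψ u) - (v - ψ u) = u - φ v by abel] at hdiff
    rw [h, Submodule.mem_bot, sub_eq_zero] at hu
    obtain rfl := Subtype.ext hu
    exact mem_negGraph.mpr ⟨v, by simp⟩
  · intro hw
    obtain ⟨v, rfl⟩ := mem_negGraph.mp hw
    refine ⟨Submodule.mem_sup.mpr ⟨_, mem_negGraph.mpr ⟨v, rfl⟩, _,
      mem_negGraph.mpr ⟨φ v, rfl⟩, by simp⟩, ?_⟩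
    exact Submodule.sub_mem _ (Submodule.mem_sup_left v.2)
      (Submodule.mem_sup_right (Subtype.prop _))

/-- `g` is a common complement of `A` and `B` in `A ⊔ B`. -/
def IsCommonCompl (A B g : Submodule F V) : Prop :=
  g ⊔ A = A ⊔ B ∧ g ⊔ B = A ⊔ B ∧ g ⊓ A = ⊥ ∧ g ⊓ B = ⊥

theorem isCommonCompl_negGraph {A B : Submodule F V} (h : A ⊓ B = ⊥) (φ : A ≃ₗ[F] B) :
    IsCommonCompl A B (negGraph φ.toLinearMap) := by
  have hle : negGraph φ.toLinearMap ≤ A ⊔ B := by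
    intro w hw
    obtain ⟨v, rfl⟩ := mem_negGraph.mp hw
    exact Submodule.sub_mem _ (Submodule.mem_sup_left v.2)
      (Submodule.mem_sup_right (Subtype.prop _))
  refine ⟨le_antisymm (sup_le hle le_sup_left) (sup_le le_sup_right fun w hw => ?_),
    le_antisymm (sup_le hle le_sup_right) (sup_le (fun v hv => ?_) le_sup_right), ?_, ?_⟩
  · exact Submodule.mem_sup.mpr ⟨_, mem_negGraph.mpr ⟨-φ.symm ⟨w, hw⟩, rfl⟩,
      _, (φ.symm ⟨w, hw⟩).2, by simp⟩
  · exact Submodule.mem_sup.mpr ⟨_, mem_negGraph.mpr ⟨⟨v, hv⟩, rfl⟩,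
      _, (φ ⟨v, hv⟩).2, by simp⟩
  · refine (Submodule.eq_bot_iff _).mpr fun w hw => ?_
    obtain ⟨v, rfl⟩ := mem_negGraph.mp hw.1
    obtain ⟨-, hv⟩ := eq_and_eq_of_sub_eq_sub (v' := ⟨_, hw.2⟩) (w' := 0) h (by simp; rfl)
    obtain rfl : v = 0 := by simpa using hv
    simp
  · refine (Submodule.eq_bot_iff _).mpr fun w hw => ?_
    obtain ⟨v, rfl⟩ := mem_negGraph.mp hw.1
    obtain ⟨rfl, -⟩ := eq_and_eq_of_sub_eq_sub (v' := 0) (w' := -⟨_, hw.2⟩) h (by simp; rfl)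
    simp

theorem IsCommonCompl.exists_negGraph_eq {A B g : Submodule F V}
    (hg : IsCommonCompl A B g) : ∃ φ : A ≃ₗ[F] B, negGraph φ.toLinearMap = g := by
  obtain ⟨hgA, hgB, hA, hB⟩ := hg
  have exB : ∀ v : A, ∃ w : B, (v : V) - w ∈ g := by
    intro v
    obtain ⟨x, hx, y, hy, hxy⟩ :=
      Submodule.mem_sup.mp (hgB ▸ Submodule.mem_sup_left v.2 : (v : V) ∈ g ⊔ B)
    exact ⟨⟨y, hy⟩, by simpa [← hxy] using hx⟩
  have exA : ∀ w : B, ∃ v : A, (v : V) - w ∈ g := by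
    intro w
    obtain ⟨x, hx, y, hy, hxy⟩ :=
      Submodule.mem_sup.mp (hgA ▸ Submodule.mem_sup_right w.2 : (w : V) ∈ g ⊔ A)
    exact ⟨⟨y, hy⟩, by simpa [← hxy] using hx⟩
  have uniqB : ∀ {v : A} {w w' : B}, (v : V) - w ∈ g → (v : V) - w' ∈ g → w = w' := by
    intro v w w' hw hw'
    have hmem : (w : V) - w' ∈ g ⊓ B :=
      ⟨by simpa using g.sub_mem hw' hw, B.sub_mem w.2 w'.2⟩
    rw [hB, Submodule.mem_bot, sub_eq_zero] at hmem
    exact Subtype.ext hmem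
  have uniqA : ∀ {v v' : A} {w : B}, (v : V) - w ∈ g → (v' : V) - w ∈ g → v = v' := by
    intro v v' w hv hv'
    have hmem : (v : V) - v' ∈ g ⊓ A :=
      ⟨by simpa using g.sub_mem hv hv', A.sub_mem v.2 v'.2⟩
    rw [hA, Submodule.mem_bot, sub_eq_zero] at hmem
    exact Subtype.ext hmem
  choose p hp using exB
  choose q hq using exA
  let φ : A ≃ₗ[F] B :=
    { toFun := p
      map_add' := fun v v' => uniqB (hp _) (by
        convert g.add_mem (hp v) (hp v') using 1
        push_cast
        abel)
      map_smul' := fun c v => uniqB (hp _) (by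
        convert g.smul_mem c (hp v) using 1
        simp [smul_sub])
      invFun := q
      left_inv := fun v => uniqA (hq _) (hp v)
      right_inv := fun w => uniqB (hp _) (hq w) }
  refine ⟨φ, le_antisymm (fun w hw => ?_) (fun w hw => ?_)⟩
  · obtain ⟨v, rfl⟩ := mem_negGraph.mp hw
    exact hp v
  · have hle : w ∈ A ⊔ B := hgA ▸ Submodule.mem_sup_left hw
    obtain ⟨v, hv, u, hu, rfl⟩ := Submodule.mem_sup.mp hle
    have hpv : p ⟨v, hv⟩ = -⟨u, hu⟩ := uniqB (hp _) (by simpa using hw)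
    refine mem_negGraph.mpr ⟨⟨v, hv⟩, ?_⟩
    change v + u = v - (p ⟨v, hv⟩ : V)
    simp [hpv]

theorem Gamma_eq_negGraph {A B : Submodule F V} (ε : A ≃ₗ[F] B) (f : A ≃ₗ[F] A) :
    Gamma ε f = negGraph (f.trans ε).toLinearMap := rfl

namespace IsFrame

variable {a : Fin n → Submodule F V} {e : Fin n → Fin n → Submodule F V}

theorem inf_eq_bot (hf : IsFrame ⊥ ⊤ a e) {i j : Fin n} (hij : i ≠ j) : a i ⊓ a j = ⊥ := by
  simpa [frameSum, Finset.singleton_inter, hij] using hf.inf_sum {i} {j}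

theorem inf_sup_eq_bot (hf : IsFrame ⊥ ⊤ a e) {i j k : Fin n} (hij : i ≠ j) (hik : i ≠ k)
    (hjk : j ≠ k) : a i ⊓ (a j ⊔ a k) = ⊥ := by
  simpa [frameSum, Finset.singleton_inter, hij, hik, hjk] using hf.inf_sum {i} {j, k}

theorem isCommonCompl (hf : IsFrame ⊥ ⊤ a e) {i j : Fin n} (hij : i ≠ j) :
    IsCommonCompl (a i) (a j) (e i j) := by
  refine ⟨?_, ?_, ?_, ?_⟩
  · rw [sup_comm, hf.sup_e i j hij]
  · rw [sup_comm, hf.symm i j, ← hf.sup_e j i hij.symm, sup_comm]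
  · rw [inf_comm, hf.inf_e i j hij]
  · rw [inf_comm, hf.symm i j, hf.inf_e j i hij.symm]

end IsFrame

theorem Gamma_trans_eq_frameMul {a : Fin 4 → Submodule F V}
    {e : Fin 4 → Fin 4 → Submodule F V} (hf : IsFrame (⊥ : Submodule F V) ⊤ a e)
    {ε : (a 0) ≃ₗ[F] (a 1)} (hε : negGraph ε.toLinearMap = e 0 1)
    (f₁ f₂ : (a 0) ≃ₗ[F] (a 0)) :
    Gamma ε (f₂.trans f₁) = frameMul a e (Gamma ε f₁) (Gamma ε f₂) := by
  obtain ⟨δ, hδ⟩ := (hf.isCommonCompl (i := 1) (j := 2) (by decide)).exists_negGraph_eq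
  have h0 : a 0 ⊓ (a 1 ⊔ a 2) = ⊥ := hf.inf_sup_eq_bot (by decide) (by decide) (by decide)
  have h1 : a 1 ⊓ (a 0 ⊔ a 2) = ⊥ := hf.inf_sup_eq_bot (by decide) (by decide) (by decide)
  have h2 : a 2 ⊓ (a 0 ⊔ a 1) = ⊥ := hf.inf_sup_eq_bot (by decide) (by decide) (by decide)
  simp only [Gamma_eq_negGraph, frameMul]
  rw [← hδ, ← hε, negGraph_sup_inf_eq_comp h1, sup_comm _ (negGraph ε.toLinearMap),
    ← negGraph_symm ε, negGraph_sup_inf_eq_comp h0, negGraph_sup_inf_eq_comp h1,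
    ← negGraph_symm δ, negGraph_sup_inf_eq_comp h2]
  congr 1
  ext v
  simp

/-- Let `ā` be a 4-frame of the subspace lattice of a vector
space `V` over a division ring.  There is a unique linear isomorphism
`ε : a₁ → a₂` with `a₁₂ = {v - ε v : v ∈ a₁}`; moreover for this `ε`, the map
`Γ : f ↦ {v - ε (f v) : v ∈ a₁}` is a bijection of `GL(a₁)` onto `G(L,ā)` and a
group isomorphism onto `(G(L,ā), (g,h) ↦ t(g,h,ā), a₁₂)`: it sends composition
to the multiplication `t`. -/
theorem frame_coordinatization
    (a : Fin 4 → Submodule F V) (e : Fin 4 → Fin 4 → Submodule F V)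
    (hf : IsFrame (⊥ : Submodule F V) ⊤ a e) :
    (∃! ε : (a 0) ≃ₗ[F] (a 1),
      ∀ w : V, w ∈ e 0 1 ↔ ∃ v : a 0, w = (v : V) - (ε v : V)) ∧
    ∀ ε : (a 0) ≃ₗ[F] (a 1),
      (∀ w : V, w ∈ e 0 1 ↔ ∃ v : a 0, w = (v : V) - (ε v : V)) →
      (∀ f : (a 0) ≃ₗ[F] (a 0), ∀ w : V,
          w ∈ Gamma ε f ↔ ∃ v : a 0, w = (v : V) - (ε (f v) : V)) ∧
      Function.Injective (fun f : (a 0) ≃ₗ[F] (a 0) => Gamma ε f) ∧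
      Set.range (fun f : (a 0) ≃ₗ[F] (a 0) => Gamma ε f) = frameG a ∧
      Gamma ε (LinearEquiv.refl F (a 0)) = e 0 1 ∧
      ∀ f₁ f₂ : (a 0) ≃ₗ[F] (a 0),
        Gamma ε (f₂.trans f₁) = frameMul a e (Gamma ε f₁) (Gamma ε f₂) := by
  have h01 : a 0 ⊓ a 1 = ⊥ := hf.inf_eq_bot (by decide)
  have graph_iff (ε : (a 0) ≃ₗ[F] (a 1)) :
      (∀ w : V, w ∈ e 0 1 ↔ ∃ v : a 0, w = (v : V) - (ε v : V)) ↔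
        negGraph ε.toLinearMap = e 0 1 := by
    simp only [SetLike.ext_iff, mem_negGraph, LinearEquiv.coe_coe]
    exact forall_congr' fun w => Iff.comm
  simp only [graph_iff]
  refine ⟨?_, fun ε hε => ⟨fun f w => ?_, ?_, ?_, hε, Gamma_trans_eq_frameMul hf hε⟩⟩
  · obtain ⟨ε, hε⟩ := (hf.isCommonCompl (i := 0) (j := 1) (by decide)).exists_negGraph_eq
    exact ⟨ε, hε, fun ε' hε' =>
      LinearEquiv.toLinearMap_injective (negGraph_injective h01 (hε'.trans hε.symm))⟩
  · rw [Gamma_eq_negGraph, mem_negGraph]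
    rfl
  · intro f f' hff'
    have htrans : f.trans ε = f'.trans ε :=
      LinearEquiv.toLinearMap_injective (negGraph_injective h01 hff')
    ext v
    simpa using congrArg (fun φ : a 0 ≃ₗ[F] a 1 => ε.symm (φ v)) htrans
  · ext g
    constructor
    · rintro ⟨f, rfl⟩
      exact isCommonCompl_negGraph h01 (f.trans ε)
    · intro hg
      obtain ⟨φ, rfl⟩ := IsCommonCompl.exists_negGraph_eq hg
      refine ⟨φ.trans ε.symm, congrArg negGraph ?_⟩
      ext v
      simp
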